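/- In the setting of biased SGD with early stopping: let f_T be bounded below by f*, with L-Lipschitz gradient, and iterates x_{t+1} = x_t − η h_t with h_t = v_t + Δ_t, where E[v_t − ∇f_T(x_t) | F_{t-1}] = 0, E[‖v_t − ∇f_T(x_t)‖² | F_{t-1}] ≤ σ_v², ‖Δ_t‖² ≤ V_t with V_1 ≤ β, V_t ≤ αV_{t-1} + U_{t-1}, E[U_t|F_{t-1}] ≤ β, α ∈ [0,1). Let f_V satisfy ‖∇f_V(x) − ∇f_T(x)‖ ≤ G d_1(μ_V,μ_T) for all x, and define τ(ε) = inf{n ≥ 1 : n ≡ 1 (mod m), ‖∇f_V(x_n)‖² ≤ ε}. If η ≤ 1/L and ε − 4Lmησ_v² − 4mβ/(1−α) − 2G²d_1(μ_V,μ_T)² > 0, then E[τ(ε)] ≤ (G²d_1² + 2(f_T(x_1)−f*)/η + ε + 2β/(1−α)) / (ε/(2m) − 2Lησ_v² − 2β/(1−α) − G²d_1²/m). -/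

import Mathlib

open MeasureTheory Finset ENNReal

section Descent

variable {E : Type*} [NormedAddCommGroup E] [InnerProductSpace ℝ E] [CompleteSpace E]

/-- The quadratic upper bound for a function with Lipschitz gradient. -/
theorem HasGradientAt.le_add_inner_add_sq_of_lipschitz {f : E → ℝ} {f' : E → E} {L : ℝ}
    (hf : ∀ x, HasGradientAt f (f' x) x) (hLip : ∀ x y, ‖f' x - f' y‖ ≤ L * ‖x - y‖) (x u : E) :
    f (x + u) ≤ f x + inner ℝ (f' x) u + L / 2 * ‖u‖ ^ 2 := by
  have hderiv (s : ℝ) : HasDerivAt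
      (fun s : ℝ => f (x + s • u) - s * inner ℝ (f' x) u - L / 2 * s ^ 2 * ‖u‖ ^ 2)
      (inner ℝ (f' (x + s • u)) u - inner ℝ (f' x) u - L * s * ‖u‖ ^ 2) s := by
    have hline : HasDerivAt (fun s : ℝ => x + s • u) u s := by
      simpa using ((hasDerivAt_id s).smul_const u).const_add x
    have hcomp := (hf (x + s • u)).hasFDerivAt.comp_hasDerivAt s hline
    rw [InnerProductSpace.toDual_apply_apply] at hcomp
    refine ((hcomp.sub ((hasDerivAt_id s).mul_const (inner ℝ (f' x) u))).sub
      ((((hasDerivAt_id s).pow 2).const_mul (L / 2)).mul_const (‖u‖ ^ 2))).congr_deriv ?_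
    simp only [id_eq]
    push_cast
    ring
  have hanti := antitoneOn_of_deriv_nonpos (convex_Icc (0 : ℝ) 1)
    (fun s _ => (hderiv s).continuousAt.continuousWithinAt)
    (fun s _ => (hderiv s).differentiableAt.differentiableWithinAt) (fun s hs => by
      rw [interior_Icc] at hs
      rw [(hderiv s).deriv, ← inner_sub_left]
      have hLs := hLip (x + s • u) x
      rw [add_sub_cancel_left, norm_smul, Real.norm_of_nonneg hs.1.le] at hLs
      nlinarith [real_inner_le_norm (f' (x + s • u) - f' x) u, norm_nonneg u])
  have h01 := hanti (Set.left_mem_Icc.2 zero_le_one) (Set.right_mem_Icc.2 zero_le_one) zero_le_one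
  simp only [zero_smul, one_smul, add_zero] at h01
  linarith

/-- One step of gradient descent with direction `f' x + w + δ`, where `w` is thought of as noise
and `δ` as bias. -/
theorem HasGradientAt.sq_norm_le_of_biased_step {f : E → ℝ} {f' : E → E} {L η : ℝ}
    (hf : ∀ x, HasGradientAt f (f' x) x) (hLip : ∀ x y, ‖f' x - f' y‖ ≤ L * ‖x - y‖)
    (hL : 0 < L) (hη : 0 < η) (hηL : η ≤ 1 / L) (x w δ : E) :
    ‖f' x‖ ^ 2 ≤ 2 / η * (f x - f (x - η • (f' x + w + δ))) + 2 * ‖δ‖ ^ 2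
      + 2 * L * η * ‖w‖ ^ 2 - 2 * (1 - L * η) * inner ℝ (f' x) w := by
  have hstep : f (x - η • (f' x + w + δ)) ≤ f x + η * (-inner ℝ (f' x) (f' x + w + δ)
      + L * η / 2 * ‖f' x + w + δ‖ ^ 2) := by
    have h := HasGradientAt.le_add_inner_add_sq_of_lipschitz hf hLip x (-(η • (f' x + w + δ)))
    rw [← sub_eq_add_neg, norm_neg, norm_smul, inner_neg_right, inner_smul_right,
      Real.norm_of_nonneg hη.le] at h
    linarith
  have hLη : L * η ≤ 1 := by rwa [le_div_iff₀ hL, mul_comm] at hηL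
  have hLη0 : 0 ≤ L * η := by positivity
  have hdiv : 2 * (inner ℝ (f' x) (f' x + w + δ) - L * η / 2 * ‖f' x + w + δ‖ ^ 2)
      ≤ 2 / η * (f x - f (x - η • (f' x + w + δ))) := by
    rw [div_mul_eq_mul_div (2 : ℝ) η, le_div_iff₀ hη]
    linarith
  have hsq : ‖f' x + w + δ‖ ^ 2 = ‖f' x + δ‖ ^ 2 + 2 * inner ℝ (f' x) w + 2 * inner ℝ w δ
      + ‖w‖ ^ 2 := by
    rw [add_right_comm, norm_add_sq_real (f' x + δ) w, inner_add_left, real_inner_comm w δ]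
    ring
  have hpol : ‖f' x + δ‖ ^ 2 = ‖f' x‖ ^ 2 + 2 * inner ℝ (f' x) δ + ‖δ‖ ^ 2 :=
    norm_add_sq_real _ _
  have hinner : inner ℝ (f' x) (f' x + w + δ)
      = ‖f' x‖ ^ 2 + inner ℝ (f' x) w + inner ℝ (f' x) δ := by
    rw [inner_add_right, inner_add_right, real_inner_self_eq_norm_sq]
  have hwδ : 2 * inner ℝ w δ ≤ ‖w‖ ^ 2 + ‖δ‖ ^ 2 := by
    nlinarith [norm_sub_sq_real w δ, sq_nonneg ‖w - δ‖]
  rw [hsq, hinner] at hdiv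
  nlinarith [mul_le_mul_of_nonneg_left hwδ hLη0, sq_nonneg ‖δ‖,
    mul_nonneg (sub_nonneg.2 hLη) (sq_nonneg ‖f' x + δ‖),
    mul_nonneg (sub_nonneg.2 hLη) (sq_nonneg ‖δ‖)]

end Descent

section RealSequences

/-- If `q` is nonnegative and dominates `c * p` at multiples of `m`, with `p` antitone, then
summing over blocks of length `m` loses a factor `m`. -/
theorem Antitone.mul_sum_range_mul_le {p q : ℕ → ℝ} (hp : Antitone p) {c : ℝ} (hc : 0 ≤ c) {m : ℕ}
    (hm : 1 ≤ m) (hq0 : ∀ i, 0 ≤ q i) (hq : ∀ i, i % m = 0 → c * p i ≤ q i) (K : ℕ) :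
    c / m * ∑ i ∈ range (m * K), p i ≤ ∑ i ∈ range (m * K), q i := by
  have hm0 : (0 : ℝ) < m := by exact_mod_cast hm
  induction K with
  | zero => simp
  | succ K ih =>
    rw [Nat.mul_succ, sum_range_add, sum_range_add, mul_add]
    refine add_le_add ih ?_
    calc c / m * ∑ j ∈ range m, p (m * K + j)
        ≤ c / m * ∑ _j ∈ range m, p (m * K) := by
          gcongr
          exact hp (Nat.le_add_right _ _)
      _ = c * p (m * K) := by
          rw [sum_const, card_range, nsmul_eq_mul]
          field_simp
      _ ≤ q (m * K) := hq _ (Nat.mul_mod_right m K)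
      _ ≤ ∑ j ∈ range m, q (m * K + j) :=
          single_le_sum (f := fun j => q (m * K + j)) (fun j _ => hq0 _) (mem_range.2 hm)

/-- A geometric drift condition bounds the partial sums. -/
theorem sum_range_le_of_geometric_drift {r p : ℕ → ℝ} {α β : ℝ} (hα0 : 0 ≤ α) (hα1 : α < 1)
    (hβ : 0 ≤ β) (hr0 : ∀ i, 0 ≤ r i) (hp0 : ∀ i, 0 ≤ p i) (hr : r 0 ≤ β)
    (hdrift : ∀ i, r (i + 1) ≤ α * r i + β * p i) (N : ℕ) :
    ∑ i ∈ range N, r i ≤ β / (1 - α) * (1 + ∑ i ∈ range N, p i) := by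
  have hstep : ∑ i ∈ range N, r i ≤ α * ∑ i ∈ range N, r i + β * (1 + ∑ i ∈ range N, p i) := by
    cases N with
    | zero => simpa
    | succ N =>
      have hmono : ∑ i ∈ range N, (α * r i + β * p i)
          ≤ ∑ i ∈ range (N + 1), (α * r i + β * p i) :=
        sum_le_sum_of_subset_of_nonneg (range_subset_range.2 N.le_succ) fun i _ _ =>
          add_nonneg (mul_nonneg hα0 (hr0 i)) (mul_nonneg hβ (hp0 i))
      have hshift : ∑ i ∈ range N, r (i + 1) ≤ ∑ i ∈ range N, (α * r i + β * p i) :=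
        sum_le_sum fun i _ => hdrift i
      rw [sum_add_distrib (s := range (N + 1)), ← mul_sum, ← mul_sum] at hmono
      rw [mul_add β, mul_one]
      linarith [sum_range_succ' r N]
  rw [div_mul_eq_mul_div, le_div_iff₀ (sub_pos.2 hα1)]
  linarith

theorem sum_range_sub_le_of_le {a b : ℕ → ℝ} (hab : ∀ i, a (i + 1) ≤ b i) (hb : ∀ i, 0 ≤ b i)
    (ha : 0 ≤ a 0) (N : ℕ) : ∑ i ∈ range N, (a i - b i) ≤ a 0 := by
  cases N with
  | zero => simpa
  | succ N =>
    have h : ∑ i ∈ range N, a (i + 1) ≤ ∑ i ∈ range N, b i := sum_le_sum fun i _ => hab i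
    rw [sum_sub_distrib, sum_range_succ', sum_range_succ]
    linarith [hb N]

/-- The energy balance behind the bound on the expected stopping time. -/
theorem mul_sum_range_le_of_energy_balance {p q a b r : ℕ → ℝ} {α β η c S : ℝ} {m : ℕ}
    (hm : 1 ≤ m) (hη : 0 < η) (hc : 0 ≤ c) (hα0 : 0 ≤ α) (hα1 : α < 1) (hβ : 0 ≤ β)
    (hp : Antitone p) (hp0 : ∀ i, 0 ≤ p i)
    (hq0 : ∀ i, 0 ≤ q i) (hq : ∀ i, i % m = 0 → c * p i ≤ q i)
    (hr0 : ∀ i, 0 ≤ r i) (hr : r 0 ≤ β) (hdrift : ∀ i, r (i + 1) ≤ α * r i + β * p i)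
    (hab : ∀ i, a (i + 1) ≤ b i) (hb : ∀ i, 0 ≤ b i) (ha : 0 ≤ a 0)
    (hbal : ∀ i, q i ≤ 2 / η * (a i - b i) + 2 * r i + S * p i) (K : ℕ) :
    (c / m - S - 2 * β / (1 - α)) * ∑ i ∈ range (m * K), p i
      ≤ 2 / η * a 0 + 2 * β / (1 - α) := by
  have hsum := sum_le_sum fun i (_ : i ∈ range (m * K)) => hbal i
  rw [sum_add_distrib, sum_add_distrib, ← mul_sum, ← mul_sum, ← mul_sum] at hsum
  have htel := mul_le_mul_of_nonneg_left (sum_range_sub_le_of_le hab hb ha (m * K))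
    (by positivity : 0 ≤ 2 / η)
  have hgeo := sum_range_le_of_geometric_drift hα0 hα1 hβ hr0 hp0 hr hdrift (m * K)
  have hblock := hp.mul_sum_range_mul_le hc hm hq0 hq K
  rw [mul_div_assoc]
  linarith

end RealSequences

section Measure

variable {Ω : Type*} {m m0 : MeasurableSpace Ω} {μ : Measure Ω}

theorem measurableSet_forall_le_not {P : ℕ → Ω → Prop} {n : ℕ}
    (hP : ∀ k ≤ n, MeasurableSet[m] {ω | P k ω}) : MeasurableSet[m] {ω | ∀ k ≤ n, ¬ P k ω} := by
  have heq : {ω | ∀ k ≤ n, ¬ P k ω} = ⋂ k, ⋂ _ : k ≤ n, {ω | P k ω}ᶜ := by ext ω; simp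
  rw [heq]
  exact MeasurableSet.iInter fun k => MeasurableSet.iInter fun hk => (hP k hk).compl

/-- A stopping time has expectation at most the sum of its tail probabilities. -/
theorem lintegral_sInf_le_tsum_measure {P : ℕ → Ω → Prop}
    (hmeas : ∀ n, MeasurableSet {ω | ∀ k ≤ n, ¬ P k ω}) :
    ∫⁻ ω, ((sInf {n : ℕ∞ | ∃ k : ℕ, n = k ∧ P k ω} : ℕ∞) : ℝ≥0∞) ∂μ
      ≤ ∑' n, μ {ω | ∀ k ≤ n, ¬ P k ω} := by
  calc _ ≤ ∫⁻ ω, ∑' n, {ω | ∀ k ≤ n, ¬ P k ω}.indicator 1 ω ∂μ := ?_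
    _ = ∑' n, μ {ω | ∀ k ≤ n, ¬ P k ω} := by
      rw [lintegral_tsum fun n => (measurable_one.indicator (hmeas n)).aemeasurable]
      simp_rw [lintegral_indicator_one (hmeas _)]
  refine lintegral_mono fun ω => ?_
  by_cases h : ∃ k, P k ω
  · classical
    have hle : (sInf {n : ℕ∞ | ∃ k : ℕ, n = k ∧ P k ω} : ℕ∞) ≤ (Nat.find h : ℕ∞) :=
      sInf_le ⟨_, rfl, Nat.find_spec h⟩
    calc _ ≤ (((Nat.find h : ℕ∞)) : ℝ≥0∞) := by exact_mod_cast hle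
      _ = ∑ n ∈ range (Nat.find h), {ω | ∀ k ≤ n, ¬ P k ω}.indicator (1 : Ω → ℝ≥0∞) ω := by
        rw [sum_congr rfl (g := fun _ => 1)]
        · simp
        · intro n hn
          exact Set.indicator_of_mem (s := {ω | ∀ k ≤ n, ¬ P k ω})
            (fun k hk => Nat.find_min h (hk.trans_lt (mem_range.1 hn))) _
      _ ≤ _ := ENNReal.sum_le_tsum _
  · push Not at h
    have : ∑' n, {ω | ∀ k ≤ n, ¬ P k ω}.indicator (1 : Ω → ℝ≥0∞) ω = ⊤ := by
      rw [tsum_congr (g := fun _ => 1) fun n =>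
        Set.indicator_of_mem (s := {ω | ∀ k ≤ n, ¬ P k ω}) (fun k _ => h k) _]
      exact ENNReal.tsum_const_eq_top_of_ne_zero one_ne_zero
    exact this ▸ le_top

theorem setIntegral_le_mul_of_condExp_le [IsFiniteMeasure μ] (hm : m ≤ m0) {f : Ω → ℝ} {c : ℝ}
    (hf : Integrable f μ) (hfc : ∀ᵐ ω ∂μ, (μ[f|m]) ω ≤ c) {s : Set Ω} (hs : MeasurableSet[m] s) :
    ∫ ω in s, f ω ∂μ ≤ c * μ.real s := by
  rw [← setIntegral_condExp hm hf hs]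
  refine (setIntegral_mono_ae integrable_condExp.integrableOn
    (integrable_const c).integrableOn hfc).trans_eq ?_
  simp [mul_comm]

theorem MeasureTheory.MemLp.comp_of_lipschitz [IsFiniteMeasure μ] {E : Type*}
    [NormedAddCommGroup E] {p : ℝ≥0∞} {f : Ω → E} {g : E → E} {L : ℝ}
    (hf : MemLp f p μ) (hL : 0 ≤ L) (hLip : ∀ x y, ‖g x - g y‖ ≤ L * ‖x - y‖) :
    MemLp (fun ω => g (f ω)) p μ := by
  have hlip : LipschitzWith ⟨L, hL⟩ g := LipschitzWith.of_dist_le_mul fun x y => by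
    rw [dist_eq_norm, dist_eq_norm]
    exact hLip x y
  have hsub : MemLp (fun ω => g (f ω) - g 0) p μ :=
    hf.of_le_mul (c := L) ((hlip.continuous.comp_aestronglyMeasurable hf.1).sub
      aestronglyMeasurable_const) (.of_forall fun ω => by simpa using hLip (f ω) 0)
  convert hsub.add (memLp_const (g 0)) using 1
  ext ω
  simp

variable {E : Type*} [NormedAddCommGroup E] [InnerProductSpace ℝ E]

theorem setIntegral_inner_eq_zero_of_condExp_eq_zero [CompleteSpace E] [IsFiniteMeasure μ]
    (hm : m ≤ m0) {f g : Ω → E} (hf : StronglyMeasurable[m] f) (hg : Integrable g μ)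
    (hfg : Integrable (fun ω => inner ℝ (f ω) (g ω)) μ) (hg0 : μ[g|m] =ᵐ[μ] 0) {s : Set Ω}
    (hs : MeasurableSet[m] s) :
    ∫ ω in s, inner ℝ (f ω) (g ω) ∂μ = 0 := by
  rw [← setIntegral_condExp hm hfg hs]
  have hpull := condExp_bilin_of_stronglyMeasurable_left (innerSL ℝ) hf hfg hg
  refine integral_eq_zero_of_ae (ae_restrict_of_ae ?_)
  filter_upwards [hpull, hg0] with ω h1 h2
  exact h1.trans (by simp [h2])

theorem MeasureTheory.MemLp.integrable_inner_of_two {f g : Ω → E} (hf : MemLp f 2 μ)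
    (hg : MemLp g 2 μ) : Integrable (fun ω => inner ℝ (f ω) (g ω)) μ := by
  refine ((hf.integrable_norm_pow two_ne_zero).add (hg.integrable_norm_pow two_ne_zero)).mono'
    (hf.1.inner hg.1) (.of_forall fun ω => ?_)
  simp only [Pi.add_apply]
  nlinarith [norm_inner_le_norm (𝕜 := ℝ) (f ω) (g ω), two_mul_le_add_sq ‖f ω‖ ‖g ω‖,
    sq_nonneg ‖f ω‖, sq_nonneg ‖g ω‖]

end Measure

theorem HasGradientAt.measurable {E : Type*} [NormedAddCommGroup E] [InnerProductSpace ℝ E]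
    [CompleteSpace E] [MeasurableSpace E] [BorelSpace E] {f : E → ℝ} {f' : E → E}
    (hf : ∀ x, HasGradientAt f (f' x) x) : Measurable f' := by
  have h : f' = fun x => (InnerProductSpace.toDual ℝ E).symm (fderiv ℝ f x) := by
    funext x
    rw [(hf x).hasFDerivAt.fderiv, LinearIsometryEquiv.symm_apply_apply]
  rw [h]
  exact (InnerProductSpace.toDual ℝ E).symm.continuous.measurable.comp (measurable_fderiv ℝ f)

theorem biased_sgd_early_stopping_expected_time
    {Ω : Type*} {m0 : MeasurableSpace Ω} (μ : Measure Ω) [IsProbabilityMeasure μ]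
    (ℱ : Filtration ℕ m0)
    {d : ℕ}
    (fT fV : EuclideanSpace ℝ (Fin d) → ℝ)
    (fT' fV' : EuclideanSpace ℝ (Fin d) → EuclideanSpace ℝ (Fin d))
    (hgradT : ∀ x, HasGradientAt fT (fT' x) x)
    (hgradV : ∀ x, HasGradientAt fV (fV' x) x)
    (L : ℝ) (hL : 0 < L)
    (hLip : ∀ x₁ x₂, ‖fT' x₁ - fT' x₂‖ ≤ L * ‖x₁ - x₂‖)
    (fstar : ℝ) (hlb : ∀ x, fstar ≤ fT x)
    -- distance between validation and training gradients, `d₁ = d₁(μ_V, μ_T)`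
    (G d₁ : ℝ) (hGd : 0 ≤ G * d₁)
    (hVT : ∀ x, ‖fV' x - fT' x‖ ≤ G * d₁)
    (σv : ℝ) (hσv : 0 ≤ σv) (m : ℕ) (hm : 1 ≤ m) (ε : ℝ) (hε : 0 < ε)
    (α β : ℝ) (hα0 : 0 ≤ α) (hα1 : α < 1) (hβ : 0 ≤ β)
    (η : ℝ) (hη0 : 0 < η) (hηL : η ≤ 1 / L)
    (hpos : 0 < ε - 4 * L * m * η * σv ^ 2 - 4 * m * β / (1 - α) - 2 * G ^ 2 * d₁ ^ 2)
    -- iterates, unbiased part `v`, bias `Δ`, and the drift variables `V`, `U`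
    (x v Δ : ℕ → Ω → EuclideanSpace ℝ (Fin d))
    (V U : ℕ → Ω → ℝ)
    (x₁ : EuclideanSpace ℝ (Fin d)) (hinit : x 1 = fun _ => x₁)
    (hrec : ∀ t, 1 ≤ t → x (t + 1) = fun ω => x t ω - η • (v t ω + Δ t ω))
    -- adaptedness
    (hxmeas : ∀ t, 1 ≤ t → StronglyMeasurable[ℱ (t - 1)] (x t))
    (hvmeas : ∀ t, StronglyMeasurable[ℱ t] (v t))
    (hΔmeas : ∀ t, StronglyMeasurable[ℱ t] (Δ t))
    (hVmeas : ∀ t, StronglyMeasurable[ℱ t] (V t))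
    (hUmeas : ∀ t, StronglyMeasurable[ℱ t] (U t))
    -- integrability
    (hvint : ∀ t, Integrable (fun ω => v t ω - fT' (x t ω)) μ)
    (hvint2 : ∀ t, Integrable (fun ω => ‖v t ω - fT' (x t ω)‖ ^ 2) μ)
    (hUint : ∀ t, Integrable (U t) μ) (hVint : ∀ t, Integrable (V t) μ)
    -- Assumption 5: unbiasedness and bounded variance of `v`
    (hmart : ∀ t, 1 ≤ t → μ[fun ω => v t ω - fT' (x t ω)|ℱ (t - 1)] =ᵐ[μ] 0)
    (hvar : ∀ t, 1 ≤ t →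
      ∀ᵐ ω ∂μ, (μ[fun ω' => ‖v t ω' - fT' (x t ω')‖ ^ 2|ℱ (t - 1)]) ω ≤ σv ^ 2)
    -- Assumption 6: geometric drift condition on the bias
    (hΔV : ∀ t ω, 1 ≤ t → ‖Δ t ω‖ ^ 2 ≤ V t ω)
    (hV1 : ∀ᵐ ω ∂μ, V 1 ω ≤ β)
    (hdrift : ∀ t, 2 ≤ t → ∀ᵐ ω ∂μ, V t ω ≤ α * V (t - 1) ω + U (t - 1) ω)
    (hUcond : ∀ t, 1 ≤ t → ∀ᵐ ω ∂μ, (μ[U t|ℱ (t - 1)]) ω ≤ β)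
    (hVnonneg : ∀ t ω, 0 ≤ V t ω) (hUnonneg : ∀ t ω, 0 ≤ U t ω)
    -- the stopping time
    (τ : Ω → ℕ∞)
    (hτ : ∀ ω, τ ω = sInf {n : ℕ∞ | ∃ k : ℕ, n = k ∧ 1 ≤ k ∧ k % m = 1 % m ∧
        ‖fV' (x k ω)‖ ^ 2 ≤ ε}) :
    ∫⁻ ω, (τ ω : ℝ≥0∞) ∂μ
      ≤ ENNReal.ofReal
          ((G ^ 2 * d₁ ^ 2 + 2 * (fT x₁ - fstar) / η + ε + 2 * β / (1 - α))
            / (ε / (2 * m) - 2 * L * η * σv ^ 2 - 2 * β / (1 - α)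
                - G ^ 2 * d₁ ^ 2 / m)) := by
  have hm0 : (0 : ℝ) < m := by exact_mod_cast hm
  have hm1 : (1 : ℝ) ≤ m := by exact_mod_cast hm
  have h1α : 0 < 1 - α := sub_pos.2 hα1
  have hℱ : ∀ t, ℱ t ≤ m0 := ℱ.le
  -- square integrability of the iterates and the gradients
  have hw2 : ∀ t, MemLp (fun ω => v t ω - fT' (x t ω)) 2 μ := fun t =>
    (memLp_two_iff_integrable_sq_norm (hvint t).1).2 (hvint2 t)
  have hΔ2 : ∀ t, 1 ≤ t → MemLp (Δ t) 2 μ := fun t ht => by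
    have hmeas := ((hΔmeas t).mono (hℱ t)).aestronglyMeasurable (μ := μ)
    refine (memLp_two_iff_integrable_sq_norm hmeas).2 ((hVint t).mono' (hmeas.norm.pow 2) ?_)
    exact .of_forall fun ω => by simpa using hΔV t ω ht
  have hrec' : ∀ t, 1 ≤ t → ∀ ω, x (t + 1) ω
      = x t ω - η • (fT' (x t ω) + (v t ω - fT' (x t ω)) + Δ t ω) := fun t ht ω => by
    rw [hrec t ht, add_sub_cancel]
  have hx2 : ∀ t, 1 ≤ t → MemLp (x t) 2 μ := by
    intro t ht
    induction t, ht using Nat.le_induction with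
    | base => rw [hinit]; exact memLp_const _
    | succ t ht ih =>
      rw [funext (hrec' t ht)]
      exact ih.sub ((((ih.comp_of_lipschitz hL.le hLip).add (hw2 t)).add (hΔ2 t ht)).const_smul η)
  have hg2 : ∀ t, 1 ≤ t → MemLp (fun ω => fT' (x t ω)) 2 μ := fun t ht =>
    (hx2 t ht).comp_of_lipschitz hL.le hLip
  have hgcont : Continuous fT' :=
    (LipschitzWith.of_dist_le_mul (K := ⟨L, hL.le⟩) fun y z => by
      rw [dist_eq_norm, dist_eq_norm]
      exact hLip y z).continuous
  have hfcont : Continuous fT :=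
    continuous_iff_continuousAt.2 fun y => (hgradT y).continuousAt
  have hfint : ∀ t, 1 ≤ t → Integrable (fun ω => fT (x t ω) - fstar) μ := fun t ht => by
    have hxs : MemLp (fun ω => x t ω - x₁) 2 μ := (hx2 t ht).sub (memLp_const x₁)
    have hdom : Integrable (fun ω => fT x₁ - fstar + inner ℝ (fT' x₁) (x t ω - x₁)
        + L / 2 * ‖x t ω - x₁‖ ^ 2) μ :=
      ((integrable_const _).add ((memLp_const (fT' x₁)).integrable_inner_of_two hxs)).add
        ((hxs.integrable_norm_pow two_ne_zero).const_mul _)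
    refine hdom.mono' ((hfcont.comp_aestronglyMeasurable (hx2 t ht).1).sub
      aestronglyMeasurable_const) (.of_forall fun ω => ?_)
    rw [Real.norm_of_nonneg (sub_nonneg.2 (hlb _))]
    have h := HasGradientAt.le_add_inner_add_sq_of_lipschitz hgradT hLip x₁ (x t ω - x₁)
    rw [add_sub_cancel] at h
    linarith
  -- the tail events of the stopping time
  set P : ℕ → Ω → Prop := fun k ω => 1 ≤ k ∧ k % m = 1 % m ∧ ‖fV' (x k ω)‖ ^ 2 ≤ ε with hP
  set D : ℕ → Set Ω := fun n => {ω | ∀ k ≤ n, ¬ P k ω}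
  have hDmeas : ∀ n, MeasurableSet[ℱ (n - 1)] (D n) := fun n => by
    refine measurableSet_forall_le_not fun k hk => ?_
    by_cases h1 : 1 ≤ k
    · have hnorm : Measurable[ℱ (k - 1)] fun ω => ‖fV' (x k ω)‖ ^ 2 :=
        ((HasGradientAt.measurable hgradV).norm.pow_const 2).comp (hxmeas k h1).measurable
      exact (MeasurableSet.const _).inter ((MeasurableSet.const _).inter
        (ℱ.mono (Nat.sub_le_sub_right hk 1) _ (hnorm measurableSet_Iic)))
    · simp only [hP, h1, false_and]
      exact MeasurableSet.const _
  have hDmeas' : ∀ n, MeasurableSet (D n) := fun n => hℱ _ _ (hDmeas n)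
  have hDanti : Antitone D := fun i j hij ω hω k hk => hω k (hk.trans hij)
  have hsub : ∀ i, D (i + 1 + 1) ⊆ D (i + 1) := fun i => hDanti (i + 1).le_succ
  -- the quantities entering the energy balance
  set p : ℕ → ℝ := fun i => μ.real (D (i + 1)) with hp
  set q : ℕ → ℝ := fun i => ∫ ω in D (i + 1), ‖fT' (x (i + 1) ω)‖ ^ 2 ∂μ
  set a : ℕ → ℝ := fun i => ∫ ω in D (i + 1), (fT (x (i + 1) ω) - fstar) ∂μ with ha
  set b : ℕ → ℝ := fun i => ∫ ω in D (i + 1), (fT (x (i + 1 + 1) ω) - fstar) ∂μ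
  set r : ℕ → ℝ := fun i => ∫ ω in D (i + 1), V (i + 1) ω ∂μ
  set c : ℝ := ε / 2 - G ^ 2 * d₁ ^ 2 with hc
  have h1i : ∀ i : ℕ, 1 ≤ i + 1 := fun i => Nat.le_add_left 1 i
  have hp_anti : Antitone p := fun i j hij => measureReal_mono (hDanti (Nat.succ_le_succ hij))
  have hc0 : 0 ≤ c := by
    have h1 : 0 ≤ 4 * L * m * η * σv ^ 2 := by positivity
    have h2 : 0 ≤ 4 * m * β / (1 - α) := by positivity
    linarith
  have hq0 : ∀ i, 0 ≤ q i := fun i => integral_nonneg fun ω => by positivity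
  have hqc : ∀ i, i % m = 0 → c * p i ≤ q i := fun i hi => by
    have hmod : (i + 1) % m = 1 % m := by rw [Nat.add_mod, hi, zero_add, Nat.mod_mod]
    have hconst : c * p i = ∫ _ω in D (i + 1), c ∂μ := by simp [hp, mul_comm]
    rw [hconst]
    refine setIntegral_mono_on (integrable_const c).integrableOn
      ((hg2 _ (h1i i)).integrable_norm_pow two_ne_zero).integrableOn (hDmeas' _) fun ω hω => ?_
    have hlt : ε < ‖fV' (x (i + 1) ω)‖ ^ 2 :=
      not_le.1 fun hle => hω (i + 1) le_rfl ⟨h1i i, hmod, hle⟩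
    have htri := norm_le_norm_sub_add (fV' (x (i + 1) ω)) (fT' (x (i + 1) ω))
    have hle : ‖fV' (x (i + 1) ω)‖ ≤ G * d₁ + ‖fT' (x (i + 1) ω)‖ :=
      htri.trans (by linarith [hVT (x (i + 1) ω)])
    have hsq := pow_le_pow_left₀ (norm_nonneg _) hle 2
    have hadd := add_sq_le (a := G * d₁) (b := ‖fT' (x (i + 1) ω)‖)
    rw [mul_pow] at hadd
    linarith
  have hr0 : ∀ i, 0 ≤ r i := fun i => integral_nonneg fun ω => hVnonneg _ ω
  have hrβ : r 0 ≤ β := by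
    calc r 0 ≤ ∫ _ω in D 1, β ∂μ :=
          setIntegral_mono_ae (hVint 1).integrableOn (integrable_const β).integrableOn hV1
      _ = μ.real (D 1) * β := by simp
      _ ≤ β := mul_le_of_le_one_left hβ measureReal_le_one
  have hdr : ∀ i, r (i + 1) ≤ α * r i + β * p i := fun i => by
    have hint : Integrable (fun ω => α * V (i + 1) ω + U (i + 1) ω) μ :=
      ((hVint _).const_mul α).add (hUint _)
    calc r (i + 1) ≤ ∫ ω in D (i + 1 + 1), (α * V (i + 1) ω + U (i + 1) ω) ∂μ :=
          setIntegral_mono_ae (hVint _).integrableOn hint.integrableOn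
            (hdrift (i + 1 + 1) (by lia))
      _ ≤ ∫ ω in D (i + 1), (α * V (i + 1) ω + U (i + 1) ω) ∂μ :=
          setIntegral_mono_set hint.integrableOn (.of_forall fun ω =>
            add_nonneg (mul_nonneg hα0 (hVnonneg _ ω)) (hUnonneg _ ω)) (hsub i).eventuallyLE
      _ = α * r i + ∫ ω in D (i + 1), U (i + 1) ω ∂μ := by
          rw [integral_add ((hVint _).const_mul α).integrableOn (hUint _).integrableOn,
            integral_const_mul]
      _ ≤ α * r i + β * p i := by
          gcongr
          exact setIntegral_le_mul_of_condExp_le (hℱ _) (hUint _) (hUcond _ (h1i i)) (hDmeas _)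
  have hab : ∀ i, a (i + 1) ≤ b i := fun i =>
    setIntegral_mono_set (hfint _ (by lia)).integrableOn
      (.of_forall fun ω => sub_nonneg.2 (hlb _)) (hsub i).eventuallyLE
  have hb0 : ∀ i, 0 ≤ b i := fun i => integral_nonneg fun ω => sub_nonneg.2 (hlb _)
  have ha0 : 0 ≤ a 0 := integral_nonneg fun ω => sub_nonneg.2 (hlb _)
  have ha1 : a 0 ≤ fT x₁ - fstar := by
    have : a 0 = μ.real (D 1) * (fT x₁ - fstar) := by simp [ha, hinit]
    rw [this]
    exact mul_le_of_le_one_left (sub_nonneg.2 (hlb _)) measureReal_le_one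
  have hbal : ∀ i, q i ≤ 2 / η * (a i - b i) + 2 * r i + (2 * L * η * σv ^ 2) * p i := fun i => by
    set t := i + 1
    have i1 : IntegrableOn (fun ω => 2 / η * ((fT (x t ω) - fstar) - (fT (x (t + 1) ω) - fstar)))
        (D t) μ := (((hfint t (h1i i)).sub (hfint (t + 1) (by lia))).const_mul _).integrableOn
    have i2 : IntegrableOn (fun ω => 2 * V t ω) (D t) μ := ((hVint t).const_mul 2).integrableOn
    have i3 : IntegrableOn (fun ω => 2 * L * η * ‖v t ω - fT' (x t ω)‖ ^ 2) (D t) μ :=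
      ((hvint2 t).const_mul _).integrableOn
    have hinn := (hg2 t (h1i i)).integrable_inner_of_two (hw2 t)
    have i4 : IntegrableOn (fun ω => 2 * (1 - L * η) *
        inner ℝ (fT' (x t ω)) (v t ω - fT' (x t ω))) (D t) μ := (hinn.const_mul _).integrableOn
    have i12 : IntegrableOn (fun ω => 2 / η * ((fT (x t ω) - fstar) - (fT (x (t + 1) ω) - fstar))
        + 2 * V t ω) (D t) μ := i1.add i2
    have i123 : IntegrableOn (fun ω => 2 / η * ((fT (x t ω) - fstar) - (fT (x (t + 1) ω) - fstar))
        + 2 * V t ω + 2 * L * η * ‖v t ω - fT' (x t ω)‖ ^ 2) (D t) μ := i12.add i3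
    have hmono : q i ≤ ∫ ω in D t, (2 / η * ((fT (x t ω) - fstar) - (fT (x (t + 1) ω) - fstar))
        + 2 * V t ω + 2 * L * η * ‖v t ω - fT' (x t ω)‖ ^ 2
        - 2 * (1 - L * η) * inner ℝ (fT' (x t ω)) (v t ω - fT' (x t ω))) ∂μ := by
      refine integral_mono ((hg2 t (h1i i)).integrable_norm_pow two_ne_zero).integrableOn
        (i123.sub i4) fun ω => ?_
      have hstep := HasGradientAt.sq_norm_le_of_biased_step hgradT hLip hL hη0 hηL (x t ω)
        (v t ω - fT' (x t ω)) (Δ t ω)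
      rw [← hrec' t (h1i i) ω] at hstep
      rw [sub_sub_sub_cancel_right]
      linarith [hΔV t ω (h1i i)]
    rw [integral_sub i123 i4, integral_add i12 i3, integral_add i1 i2,
      integral_const_mul, integral_const_mul, integral_const_mul, integral_const_mul,
      integral_sub (hfint t (h1i i)).integrableOn (hfint (t + 1) (by lia)).integrableOn,
      setIntegral_inner_eq_zero_of_condExp_eq_zero (hℱ (t - 1))
        (hgcont.comp_stronglyMeasurable (hxmeas t (h1i i))) (hvint t) hinn (hmart t (h1i i))
        (hDmeas t), mul_zero, sub_zero] at hmono
    have hvar' := mul_le_mul_of_nonneg_left (setIntegral_le_mul_of_condExp_le (hℱ (t - 1))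
      (hvint2 t) (hvar t (h1i i)) (hDmeas t)) (by positivity : 0 ≤ 2 * L * η)
    rw [← mul_assoc] at hvar'
    exact hmono.trans (add_le_add_right hvar' _)
  -- conclusion
  set C : ℝ := ε / (2 * m) - 2 * L * η * σv ^ 2 - 2 * β / (1 - α) - G ^ 2 * d₁ ^ 2 / m with hC
  have hCc : C = c / m - 2 * L * η * σv ^ 2 - 2 * β / (1 - α) := by
    rw [hC, hc]
    field_simp
    ring
  have hC0 : 0 < C := by
    have : C = (ε - 4 * L * m * η * σv ^ 2 - 4 * m * β / (1 - α) - 2 * G ^ 2 * d₁ ^ 2)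
        / (2 * m) := by
      rw [hC]
      field_simp
      ring
    rw [this]
    positivity
  have hCε : C ≤ ε := by
    have h1 : ε / (2 * m) ≤ ε := div_le_self hε.le (by linarith)
    have h2 : 0 ≤ 2 * L * η * σv ^ 2 := by positivity
    have h3 : 0 ≤ 2 * β / (1 - α) := by positivity
    have h4 : 0 ≤ G ^ 2 * d₁ ^ 2 / m := by positivity
    linarith
  have hsum : ∀ K, 1 + ∑ i ∈ range (m * K), p i
      ≤ (G ^ 2 * d₁ ^ 2 + 2 * (fT x₁ - fstar) / η + ε + 2 * β / (1 - α)) / C := fun K => by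
    have h := mul_sum_range_le_of_energy_balance hm hη0 hc0 hα0 hα1 hβ hp_anti
      (fun _ => measureReal_nonneg) hq0 hqc hr0 hrβ hdr hab hb0 ha0 hbal K
    rw [← hCc] at h
    have h1 : 2 / η * a 0 ≤ 2 * (fT x₁ - fstar) / η := by
      rw [mul_div_right_comm]
      gcongr
    have h2 : 0 ≤ G ^ 2 * d₁ ^ 2 := by positivity
    rw [le_div_iff₀ hC0]
    linarith
  simp_rw [hτ]
  refine (lintegral_sInf_le_tsum_measure hDmeas').trans
    (ENNReal.tsum_le_of_sum_range_le fun N => ?_)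
  calc ∑ n ∈ range N, μ (D n) ≤ ∑ n ∈ range (m * N + 1), μ (D n) :=
        sum_le_sum_of_subset (range_subset_range.2 (by nlinarith))
    _ ≤ ∑ i ∈ range (m * N), ENNReal.ofReal (p i) + ENNReal.ofReal 1 := by
        rw [sum_range_succ', ENNReal.ofReal_one]
        gcongr with i
        · exact (ofReal_measureReal).ge
        · exact prob_le_one
    _ = ENNReal.ofReal (1 + ∑ i ∈ range (m * N), p i) := by
        rw [← ENNReal.ofReal_sum_of_nonneg fun _ _ => measureReal_nonneg, add_comm,
          ENNReal.ofReal_add zero_le_one (sum_nonneg fun _ _ => measureReal_nonneg)]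
    _ ≤ _ := ENNReal.ofReal_le_ofReal (hsum N)
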